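/- arXiv:1911.07287 — 2 statements merged into one kernel-verified Lean document; each statement's English description precedes it below -/
import Mathlib

section
/- There exists a constant C_Sal > 0 such that for every integer m > 1 there exists a constant K > 0 (depending only on m) with the following property: every m-intersecting family of n pairwise intersecting closed Jordan curves in general position in the plane has at most K · n^(2 − C_Sal/m) touching pairs. -/
noncomputable section

abbrev Plane : Type := EuclideanSpace ℝ (Fin 2)

/-- A closed Jordan curve: a subset of the plane homeomorphic to the unit circle. -/
def IsJordanCurve (γ : Set Plane) : Prop :=
  Nonempty (γ ≃ₜ Metric.sphere (0 : Plane) 1)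

/-- A Jordan arc: a subset of the plane homeomorphic to the closed unit interval. -/
def IsJordanArc (γ : Set Plane) : Prop :=
  Nonempty (γ ≃ₜ unitInterval)

/-- General position: any two distinct members intersect in a finite set, and no point
of the plane lies on three distinct members. -/
def GenPos {n : ℕ} (γ : Fin n → Set Plane) : Prop :=
  (∀ i j : Fin n, i ≠ j → (γ i ∩ γ j).Finite) ∧
  (∀ p : Plane, ∀ i j k : Fin n, p ∈ γ i → p ∈ γ j → p ∈ γ k → i = j ∨ i = k ∨ j = k)

/-- `m`-intersecting: any two distinct members intersect in at most `m` points. -/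
def MIntersecting {n : ℕ} (m : ℕ) (γ : Fin n → Set Plane) : Prop :=
  ∀ i j : Fin n, i ≠ j → (γ i ∩ γ j).ncard ≤ m

/-- Two curves touch if their intersection is a singleton. -/
def Touches (a b : Set Plane) : Prop := ∃ x, a ∩ b = {x}

/-- The number of touching pairs of the family. -/
def touchingPairs {n : ℕ} (γ : Fin n → Set Plane) : ℕ :=
  {p : Fin n × Fin n | p.1 < p.2 ∧ Touches (γ p.1) (γ p.2)}.ncard

/-- The set of intersection points of the family: points lying on at least two
distinct members. -/
def interPoints {n : ℕ} (γ : Fin n → Set Plane) : Set Plane :=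
  {x : Plane | ∃ i j : Fin n, i ≠ j ∧ x ∈ γ i ∧ x ∈ γ j}

/-! ### Topological strong non-planarity of `K_{3,3}` -/

/-- `d` is the change of a continuous logarithm of `g` between `0` and `1`. -/
def LogChange (g : ℝ → ℂ) (d : ℂ) : Prop :=
  ∃ L : ℝ → ℂ, Continuous L ∧ (∀ t, Complex.exp (L t) = g t) ∧ L 1 - L 0 = d

theorem LogChange.unique {g : ℝ → ℂ} {d d' : ℂ} (h : LogChange g d) (h' : LogChange g d') :
    d = d' := by
  obtain ⟨L, hL, hLe, rfl⟩ := h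
  obtain ⟨L', hL', hLe', rfl⟩ := h'
  have hcont : Continuous (fun z : ℝ => ((⟨g z, by rw [← hLe]; exact Complex.exp_ne_zero _⟩ :
      {z : ℂ // z ≠ 0}))) := by
    refine Continuous.subtype_mk ?_ _
    have : g = fun t => Complex.exp (L t) := by ext t; rw [hLe]
    rw [this]; fun_prop
  let c : ℂ := L 0 - L' 0
  have hc : Complex.exp c = 1 := by
    rw [Complex.exp_sub, hLe, hLe', div_self]
    rw [← hLe]; exact Complex.exp_ne_zero _
  have key : L = fun t => L' t + c := by
    refine Complex.isCoveringMap_exp.eq_of_comp_eq hL (by fun_prop) ?_ 0 (by simp [c])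
    ext t
    simp [Complex.exp_add, hc, hLe, hLe']
  have := congrFun key 1
  simp only [this]
  simp [c]; ring

theorem LogChange.neg {g : ℝ → ℂ} {d : ℂ} (h : LogChange g d) : LogChange (fun t => - g t) d := by
  obtain ⟨L, hL, hLe, rfl⟩ := h
  refine ⟨fun t => L t + Real.pi * Complex.I, by fun_prop, fun t => ?_, by ring⟩
  simp [Complex.exp_add, hLe]

/-- The (chosen) logarithm change. -/
def lc (g : ℝ → ℂ) : ℂ := by
  classical
  exact if h : ∃ d, LogChange g d then h.choose else 0

theorem LogChange.lc_eq {g : ℝ → ℂ} {d : ℂ} (h : LogChange g d) : lc g = d := by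
  have h' : ∃ d, LogChange g d := ⟨d, h⟩
  unfold lc
  rw [dif_pos h']
  exact h'.choose_spec.unique h

theorem exists_square_log {f g : ℝ → ℂ} (hf : Continuous f) (hg : Continuous g)
    (h : ∀ s t, f s ≠ g t) :
    ∃ L : ℝ × ℝ → ℂ, Continuous L ∧ ∀ s t, Complex.exp (L (s, t)) = f s - g t := by
  have := Complex.isCoveringMapOn_exp.existsUnique_continuousMap_lifts
    (⟨fun x : ℝ × ℝ => f x.1 - g x.2, by fun_prop⟩ : C(ℝ × ℝ, ℂ)) (a₀ := (0, 0))
    (e₀ := Complex.log (f 0 - g 0))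
    (by rw [Complex.exp_log (sub_ne_zero.mpr (h 0 0))]; rfl)
    (fun a => by simpa using (sub_ne_zero.mpr (h a.1 a.2)))
  obtain ⟨F, ⟨-, hF⟩, -⟩ := this
  exact ⟨F, F.continuous, fun s t => congrFun hF (s, t)⟩

theorem lc_square {f g : ℝ → ℂ} (hf : Continuous f) (hg : Continuous g)
    (h : ∀ s t, f s ≠ g t) :
    lc (fun s => f s - g 0) + lc (fun t => g t - f 1) - lc (fun s => f s - g 1)
      - lc (fun t => g t - f 0) = 0 := by
  obtain ⟨L, hL, hLe⟩ := exists_square_log hf hg h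
  have h1 : ∀ t, LogChange (fun s => f s - g t) (L (1, t) - L (0, t)) := fun t =>
    ⟨fun s => L (s, t), by fun_prop, fun s => hLe s t, rfl⟩
  have h2 : ∀ s, LogChange (fun t => g t - f s) (L (s, 1) - L (s, 0)) := fun s => by
    have : LogChange (fun t => f s - g t) (L (s, 1) - L (s, 0)) :=
      ⟨fun t => L (s, t), by fun_prop, fun t => hLe s t, rfl⟩
    simpa using this.neg
  rw [(h1 0).lc_eq, (h2 1).lc_eq, (h1 1).lc_eq, (h2 0).lc_eq]
  ring

theorem exp_lc {f : ℝ → ℂ} (hf : Continuous f) {w : ℂ} (h : ∀ s, f s ≠ w) :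
    Complex.exp (lc (fun s => f s - w)) = (f 1 - w) / (f 0 - w) := by
  obtain ⟨L, hL, hLe⟩ := exists_square_log hf (continuous_const (y := w)) (fun s _ => h s)
  have h1 : LogChange (fun s => f s - w) (L (1, 0) - L (0, 0)) :=
    ⟨fun s => L (s, 0), by fun_prop, fun s => hLe s 0, rfl⟩
  rw [h1.lc_eq, Complex.exp_sub, hLe, hLe]

theorem exists_int_of_exp_eq {a b : ℂ} (h : Complex.exp a = Complex.exp b) :
    ∃ n : ℤ, a = b + n * (2 * Real.pi * Complex.I) := Complex.exp_eq_exp_iff_exists_int.mp h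

/-- a logarithm of `x i - x k` with antisymmetry built in -/
def slog (x : Fin 3 → ℂ) (i k : Fin 3) : ℂ :=
  if i < k then Complex.log (x i - x k) else Complex.log (x k - x i) + Real.pi * Complex.I

theorem exp_slog {x : Fin 3 → ℂ} (hx : Function.Injective x) {i k : Fin 3} (h : i ≠ k) :
    Complex.exp (slog x i k) = x i - x k := by
  unfold slog
  split_ifs
  · rw [Complex.exp_log (sub_ne_zero.mpr (hx.ne h))]
  · rw [Complex.exp_add, Complex.exp_log (sub_ne_zero.mpr (hx.ne h.symm))]
    simp

theorem slog_symm {x : Fin 3 → ℂ} {i k : Fin 3} (h : i < k) :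
    slog x k i = slog x i k + Real.pi * Complex.I := by
  unfold slog
  rw [if_pos h, if_neg h.le.not_gt]

theorem K33_complex (u v : Fin 3 → ℂ) (p : Fin 3 → Fin 3 → ℝ → ℂ)
    (hp : ∀ i j, Continuous (p i j)) (h0 : ∀ i j, p i j 0 = u i) (h1 : ∀ i j, p i j 1 = v j)
    (hdis : ∀ i j k l, i ≠ k → j ≠ l → ∀ s t, p i j s ≠ p k l t) : False := by
  have ex : ∀ i : Fin 3, ∃ k, i ≠ k := by decide
  have hu : Function.Injective u := by
    intro i k hik
    by_contra hne
    have := hdis i 0 k 1 hne (by decide) 0 0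
    rw [h0, h0] at this
    exact this hik
  have hv : Function.Injective v := by
    intro j l hjl
    by_contra hne
    have := hdis 0 j 1 l (by decide) hne 1 1
    rw [h1, h1] at this
    exact this hjl
  have hvu : ∀ j k, v j ≠ u k := by
    intro j k
    obtain ⟨k', hk'⟩ := ex k
    obtain ⟨j', hj'⟩ := ex j
    have := hdis k' j k j' hk'.symm hj' 1 0
    rwa [h0, h1] at this
  have hpu : ∀ i j k, i ≠ k → ∀ s, p i j s ≠ u k := by
    intro i j k hik s
    obtain ⟨j', hj'⟩ := ex j
    have := hdis i j k j' hik hj' s 0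
    rwa [h0] at this
  have hpv : ∀ i j l, j ≠ l → ∀ s, p i j s ≠ v l := by
    intro i j l hjl s
    obtain ⟨i', hi'⟩ := ex i
    have := hdis i j i' l hi' hjl s 1
    rwa [h1] at this
  let X : Fin 3 → Fin 3 → ℂ := fun j k => Complex.log (v j - u k)
  have hX : ∀ j k, Complex.exp (X j k) = v j - u k := fun j k =>
    Complex.exp_log (sub_ne_zero.mpr (hvu j k))
  have hN : ∀ i j k, ∃ n : ℤ, i ≠ k → lc (fun s => p i j s - u k) =
      X j k - slog u i k + n * (2 * Real.pi * Complex.I) := by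
    intro i j k
    by_cases hik : i = k
    · exact ⟨0, fun h => absurd hik h⟩
    · obtain ⟨n, hn⟩ := exists_int_of_exp_eq (a := lc (fun s => p i j s - u k))
        (b := X j k - slog u i k) (by
          rw [exp_lc (hp i j) (hpu i j k hik), Complex.exp_sub, hX, exp_slog hu hik, h0, h1])
      exact ⟨n, fun _ => hn⟩
  have hM : ∀ i j l, ∃ n : ℤ, j ≠ l → lc (fun s => p i j s - v l) =
      slog v j l - (X l i + Real.pi * Complex.I) + n * (2 * Real.pi * Complex.I) := by
    intro i j l
    by_cases hjl : j = l
    · exact ⟨0, fun h => absurd hjl h⟩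
    · obtain ⟨n, hn⟩ := exists_int_of_exp_eq (a := lc (fun s => p i j s - v l))
        (b := slog v j l - (X l i + Real.pi * Complex.I)) (by
          rw [exp_lc (hp i j) (hpv i j l hjl), Complex.exp_sub, Complex.exp_add, hX,
            exp_slog hv hjl, h0, h1]
          simp)
      exact ⟨n, fun _ => hn⟩
  choose N hN using hN
  choose M hM using hM
  have hpi : (2 * Real.pi * Complex.I : ℂ) ≠ 0 := Complex.two_pi_I_ne_zero
  have e1 : ∀ i k j l, i < k → j < l → N i j k + M k l j - M i j l - N k l i + 1 = 0 := by
    intro i k j l hik hjl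
    have := lc_square (hp i j) (hp k l) (hdis i j k l hik.ne hjl.ne)
    rw [h0, h1, h0, h1, hN i j k hik.ne, hM k l j hjl.ne', hM i j l hjl.ne, hN k l i hik.ne',
      slog_symm hik, slog_symm hjl] at this
    have h2 : ((N i j k + M k l j - M i j l - N k l i + 1 : ℤ) : ℂ) * (2 * Real.pi * Complex.I)
        = 0 := by
      push_cast
      linear_combination this
    exact_mod_cast (mul_eq_zero.mp h2).resolve_right hpi
  have e2 : ∀ i k j l, i < k → l < j → N i j k + M k l j - M i j l - N k l i = 0 := by
    intro i k j l hik hjl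
    have := lc_square (hp i j) (hp k l) (hdis i j k l hik.ne hjl.ne')
    rw [h0, h1, h0, h1, hN i j k hik.ne, hM k l j hjl.ne, hM i j l hjl.ne', hN k l i hik.ne',
      slog_symm hik, slog_symm hjl] at this
    have h2 : ((N i j k + M k l j - M i j l - N k l i : ℤ) : ℂ) * (2 * Real.pi * Complex.I)
        = 0 := by
      push_cast
      linear_combination this
    exact_mod_cast (mul_eq_zero.mp h2).resolve_right hpi
  have l01 : (0 : Fin 3) < 1 := by decide
  have l02 : (0 : Fin 3) < 2 := by decide
  have l12 : (1 : Fin 3) < 2 := by decide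
  have a1 := e1 0 1 0 1 l01 l01
  have a2 := e1 0 1 0 2 l01 l02
  have a3 := e1 0 1 1 2 l01 l12
  have a4 := e1 0 2 0 1 l02 l01
  have a5 := e1 0 2 0 2 l02 l02
  have a6 := e1 0 2 1 2 l02 l12
  have a7 := e1 1 2 0 1 l12 l01
  have a8 := e1 1 2 0 2 l12 l02
  have a9 := e1 1 2 1 2 l12 l12
  have b1 := e2 0 1 1 0 l01 l01
  have b2 := e2 0 1 2 0 l01 l02
  have b3 := e2 0 1 2 1 l01 l12
  have b4 := e2 0 2 1 0 l02 l01
  have b5 := e2 0 2 2 0 l02 l02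
  have b6 := e2 0 2 2 1 l02 l12
  have b7 := e2 1 2 1 0 l12 l01
  have b8 := e2 1 2 2 0 l12 l02
  have b9 := e2 1 2 2 1 l12 l12
  omega

theorem K33_plane (u v : Fin 3 → Plane) (E : Fin 3 → Fin 3 → Set Plane)
    (hE : ∀ i j, JoinedIn (E i j) (u i) (v j))
    (hdis : ∀ i j k l, i ≠ k → j ≠ l → Disjoint (E i j) (E k l)) : False := by
  let q : ∀ i j, Path (u i) (v j) := fun i j => (hE i j).somePath
  let f : Plane → ℂ := fun x => x 0 + x 1 * Complex.I
  have hf : Continuous f := by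
    simp only [f]; fun_prop
  have hfi : Function.Injective f := by
    intro x y hxy
    have h1 := congrArg Complex.re hxy
    have h2 := congrArg Complex.im hxy
    simp [f] at h1 h2
    ext i
    fin_cases i <;> simp [h1, h2]
  refine K33_complex (f ∘ u) (f ∘ v) (fun i j t => f ((q i j).extend t)) (fun i j => by fun_prop)
    (by simp) (by simp) ?_
  intro i j k l hik hjl s t hst
  have h := hfi hst
  have hs : (q i j).extend s ∈ E i j := by
    have : (q i j).extend s ∈ Set.range (q i j) := by
      rw [← Path.extend_range]; exact ⟨s, rfl⟩
    obtain ⟨x, hx⟩ := this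
    rw [← hx]; exact (hE i j).somePath_mem x
  have ht : (q k l).extend t ∈ E k l := by
    have : (q k l).extend t ∈ Set.range (q k l) := by
      rw [← Path.extend_range]; exact ⟨t, rfl⟩
    obtain ⟨x, hx⟩ := this
    rw [← hx]; exact (hE k l).somePath_mem x
  rw [h] at hs
  exact Set.disjoint_left.mp (hdis i j k l hik hjl) hs ht

/-! ### Parametrised Jordan curves -/

/-- `φ` is a `1`-periodic parametrisation of `γ`, injective modulo periods. -/
structure Param (γ : Set Plane) (φ : ℝ → Plane) : Prop where
  cont : Continuous φ
  range : Set.range φ = γ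
  eq_iff : ∀ s t, φ s = φ t ↔ ∃ n : ℤ, s = t + n

theorem IsJordanCurve.exists_param {γ : Set Plane} (h : IsJordanCurve γ) :
    ∃ φ, Param γ φ := by
  obtain ⟨h⟩ := h
  let e : ℝ → Plane := fun t => !₂[Real.cos (2 * Real.pi * t), Real.sin (2 * Real.pi * t)]
  have he : Continuous e := by
    simp only [e]; fun_prop
  have hmem : ∀ t, e t ∈ Metric.sphere (0 : Plane) 1 := by
    intro t
    simp [e, EuclideanSpace.norm_eq]
  have hei : ∀ s t, e s = e t ↔ ∃ n : ℤ, s = t + n := by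
    intro s t
    have h1 : e s = e t ↔ (Real.cos (2 * Real.pi * s) = Real.cos (2 * Real.pi * t) ∧
        Real.sin (2 * Real.pi * s) = Real.sin (2 * Real.pi * t)) := by
      constructor
      · intro hst
        have h0 := congrFun (congrArg WithLp.ofLp hst) 0
        have h1 := congrFun (congrArg WithLp.ofLp hst) 1
        simpa [e] using And.intro h0 h1
      · rintro ⟨h0, h1⟩
        simp only [e, h0, h1]
    rw [h1]
    constructor
    · rintro ⟨hc, hs⟩
      have : Complex.exp ((2 * Real.pi * s : ℝ) * Complex.I) =
          Complex.exp ((2 * Real.pi * t : ℝ) * Complex.I) := by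
        rw [Complex.exp_mul_I, Complex.exp_mul_I, ← Complex.ofReal_cos, ← Complex.ofReal_sin,
          ← Complex.ofReal_cos, ← Complex.ofReal_sin, hc, hs]
      obtain ⟨n, hn⟩ := Complex.exp_eq_exp_iff_exists_int.mp this
      refine ⟨n, ?_⟩
      have h2 := congrArg Complex.im hn
      simp at h2
      have hpi := Real.pi_pos
      have h3 : (2 * Real.pi) * s = (2 * Real.pi) * (t + n) := by linarith
      exact mul_left_cancel₀ (by positivity) h3
    · rintro ⟨n, rfl⟩
      have : 2 * Real.pi * (t + n) = 2 * Real.pi * t + n * (2 * Real.pi) := by ring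
      rw [this, Real.cos_add_int_mul_two_pi, Real.sin_add_int_mul_two_pi]
      exact ⟨rfl, rfl⟩
  have hsurj : ∀ x ∈ Metric.sphere (0 : Plane) 1, ∃ t, e t = x := by
    intro x hx
    have hx' : x 0 ^ 2 + x 1 ^ 2 = 1 := by
      have : ‖x‖ = 1 := by simpa using hx
      rw [EuclideanSpace.norm_eq] at this
      have h2 := (Real.sqrt_eq_one).mp this
      simpa [Fin.sum_univ_two] using h2
    let c : ℂ := ⟨x 0, x 1⟩
    have hc : ‖c‖ = 1 := by
      rw [Complex.norm_def, Complex.normSq_mk]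
      rw [Real.sqrt_eq_one]; nlinarith
    have hc0 : c ≠ 0 := by
      intro h0; rw [h0] at hc; simp at hc
    have hpi := Real.pi_pos
    refine ⟨c.arg / (2 * Real.pi), ?_⟩
    have : 2 * Real.pi * (c.arg / (2 * Real.pi)) = c.arg := by field_simp
    simp only [e, this]
    rw [Complex.cos_arg hc0, Complex.sin_arg, hc]
    ext i; fin_cases i <;> simp [c]
  refine ⟨fun t => (h.symm ⟨e t, hmem t⟩ : Plane), ?_, ?_, ?_⟩
  · fun_prop
  · ext p
    constructor
    · rintro ⟨t, rfl⟩; exact (h.symm _).2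
    · intro hp
      obtain ⟨t, ht⟩ := hsurj _ (h ⟨p, hp⟩).2
      refine ⟨t, ?_⟩
      have : (⟨e t, hmem t⟩ : Metric.sphere (0 : Plane) 1) = h ⟨p, hp⟩ := Subtype.ext ht
      simp [this]
  · intro s t
    rw [← hei s t]
    simp [Subtype.ext_iff.symm]

namespace Param

variable {γ : Set Plane} {φ : ℝ → Plane}

theorem mem (h : Param γ φ) (t : ℝ) : φ t ∈ γ := h.range ▸ ⟨t, rfl⟩

theorem image_subset (h : Param γ φ) (s : Set ℝ) : φ '' s ⊆ γ := by
  rintro _ ⟨t, -, rfl⟩; exact h.mem t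

theorem eq_of_lt (h : Param γ φ) {s t : ℝ} (h1 : s ≤ t) (h2 : t < s + 1) (he : φ t = φ s) :
    t = s := by
  obtain ⟨n, hn⟩ := (h.eq_iff _ _).mp he
  have a : (-1 : ℝ) < n := by linarith
  have b : (n : ℝ) < 1 := by linarith
  have a' : (-1 : ℤ) < n := by exact_mod_cast a
  have b' : n < (1 : ℤ) := by exact_mod_cast b
  have : n = 0 := by omega
  simp [hn, this]

theorem injOn (h : Param γ φ) : Set.InjOn φ (Set.Ico 0 1) := by
  intro s hs t ht hst
  rcases le_total s t with h1 | h1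
  · exact (h.eq_of_lt h1 (by linarith [hs.1, ht.2]) hst.symm).symm
  · exact h.eq_of_lt h1 (by linarith [ht.1, hs.2]) hst

theorem exists_mem_Ico (h : Param γ φ) {p : Plane} (hp : p ∈ γ) (a : ℝ) :
    ∃ t ∈ Set.Ico a (a + 1), φ t = p := by
  rw [← h.range] at hp
  obtain ⟨t, rfl⟩ := hp
  refine ⟨t - ⌊t - a⌋, ⟨?_, ?_⟩, ?_⟩
  · linarith [Int.floor_le (t - a)]
  · linarith [Int.lt_floor_add_one (t - a)]
  · rw [h.eq_iff]; exact ⟨-⌊t - a⌋, by push_cast; ring⟩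

theorem joined_compl (h : Param γ φ) {a b : ℝ} (hab : a ≤ b) (hb : b < a + 1) {u v : Plane}
    (hu : u ∈ γ) (hv : v ∈ γ) (hu' : u ∉ φ '' Set.Icc a b) (hv' : v ∉ φ '' Set.Icc a b) :
    JoinedIn (γ \ φ '' Set.Icc a b) u v := by
  have key : ∀ u ∈ γ, u ∉ φ '' Set.Icc a b → ∃ s ∈ Set.Ioo b (a + 1), φ s = u := by
    intro u hu hu'
    obtain ⟨s, hs, rfl⟩ := h.exists_mem_Ico hu a
    refine ⟨s, ⟨?_, hs.2⟩, rfl⟩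
    by_contra hcon
    exact hu' ⟨s, ⟨hs.1, not_lt.mp hcon⟩, rfl⟩
  obtain ⟨s, hs, rfl⟩ := key u hu hu'
  obtain ⟨t, ht, rfl⟩ := key v hv hv'
  have hj : JoinedIn (Set.Ioo b (a + 1)) s t :=
    ((convex_Ioo b (a + 1)).isPathConnected ⟨s, hs⟩).joinedIn s hs t ht
  refine (hj.map h.cont).mono ?_
  rintro _ ⟨r, hr, rfl⟩
  refine ⟨h.mem r, ?_⟩
  rintro ⟨r', hr', he⟩
  have := h.eq_of_lt (s := r') (t := r) (by linarith [hr.1, hr'.2]) (by linarith [hr.2, hr'.1])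
    he.symm
  linarith [hr.1, hr'.2]

theorem joined_compl_uIcc (h : Param γ φ) {a b : ℝ} (ha : a ∈ Set.Ico (0 : ℝ) 1)
    (hb : b ∈ Set.Ico (0 : ℝ) 1) {u v : Plane}
    (hu : u ∈ γ) (hv : v ∈ γ) (hu' : u ∉ φ '' Set.uIcc a b) (hv' : v ∉ φ '' Set.uIcc a b) :
    JoinedIn (γ \ φ '' Set.uIcc a b) u v := by
  rcases le_total a b with hab | hab
  · rw [Set.uIcc_of_le hab] at *
    exact h.joined_compl hab (by linarith [ha.1, hb.2]) hu hv hu' hv'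
  · rw [Set.uIcc_of_ge hab] at *
    exact h.joined_compl hab (by linarith [hb.1, ha.2]) hu hv hu' hv'

theorem joined_compl_singleton (h : Param γ φ) {p u v : Plane} (hp : p ∈ γ)
    (hu : u ∈ γ) (hv : v ∈ γ) (hu' : u ≠ p) (hv' : v ≠ p) :
    JoinedIn (γ \ {p}) u v := by
  obtain ⟨s, hs, rfl⟩ := h.exists_mem_Ico hp 0
  have := h.joined_compl (le_refl s) (by linarith) hu hv (by simpa [eq_comm] using hu')
    (by simpa [eq_comm] using hv')
  simpa using this

theorem joined_uIcc (h : Param γ φ) (s t : ℝ) : JoinedIn (φ '' Set.uIcc s t) (φ s) (φ t) := by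
  have hj : JoinedIn (Set.uIcc s t) s t :=
    ((convex_uIcc s t).isPathConnected ⟨s, Set.left_mem_uIcc⟩).joinedIn s Set.left_mem_uIcc
      t Set.right_mem_uIcc
  exact hj.map h.cont

/-- Points of a Jordan curve are classified by which gap of a finite set they lie in. -/
theorem exists_class (h : Param γ φ) {Q : Set Plane} (hQ : Q.Finite) {N : ℕ}
    (hN : Q.ncard ≤ N) :
    ∃ c : ℝ → Fin (N + 1), ∀ s ∈ Set.Ico (0 : ℝ) 1, ∀ t ∈ Set.Ico (0 : ℝ) 1,
      φ s ∉ Q → φ t ∉ Q → c s = c t → Disjoint (φ '' Set.uIcc s t) Q := by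
  classical
  let P : Set ℝ := Set.Ico 0 1 ∩ φ ⁻¹' Q
  have hPinj : Set.InjOn φ P := h.injOn.mono Set.inter_subset_left
  have hPim : φ '' P ⊆ Q := by rintro _ ⟨t, ht, rfl⟩; exact ht.2
  have hPfin : P.Finite := Set.Finite.of_finite_image (hQ.subset hPim) hPinj
  have hPcard : P.ncard ≤ N := by
    rw [← hPinj.ncard_image]
    exact (Set.ncard_le_ncard hPim hQ).trans hN
  have main : ∀ s ∈ Set.Ico (0 : ℝ) 1, ∀ t ∈ Set.Ico (0 : ℝ) 1, s ≤ t → 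
      φ s ∉ Q → φ t ∉ Q → (P ∩ Set.Iio s).ncard = (P ∩ Set.Iio t).ncard →
      Disjoint (φ '' Set.Icc s t) Q := by
    intro s hs t ht hst hsQ htQ hc
    have hsub : P ∩ Set.Iio s ⊆ P ∩ Set.Iio t := by
      rintro r ⟨hr, hr'⟩; exact ⟨hr, lt_of_lt_of_le hr' hst⟩
    have heq := Set.eq_of_subset_of_ncard_le hsub hc.ge (hPfin.subset Set.inter_subset_left)
    rw [Set.disjoint_left]
    rintro _ ⟨r, hr, rfl⟩ hrQ
    have hrt : r ≠ t := by rintro rfl; exact htQ hrQ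
    have : r ∈ P ∩ Set.Iio t :=
      ⟨⟨⟨hs.1.trans hr.1, lt_of_le_of_lt hr.2 ht.2⟩, hrQ⟩, lt_of_le_of_ne hr.2 hrt⟩
    rw [← heq] at this
    exact absurd this.2 (not_lt.mpr hr.1)
  refine ⟨fun s => ⟨(P ∩ Set.Iio s).ncard, ?_⟩, ?_⟩
  · exact Nat.lt_succ_of_le ((Set.ncard_le_ncard Set.inter_subset_left hPfin).trans hPcard)
  · intro s hs t ht hsQ htQ hc
    have hc' : (P ∩ Set.Iio s).ncard = (P ∩ Set.Iio t).ncard := by simpa using hc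
    rcases le_total s t with hst | hst
    · rw [Set.uIcc_of_le hst]; exact main s hs t ht hst hsQ htQ hc'
    · rw [Set.uIcc_of_ge hst]; exact main t ht s hs hst htQ hsQ hc'.symm

end Param

theorem disjoint_aux {α : Type} {a1 a2 b1 b2 b3 X Y R β : Set α} {x1 y1 w1 x2 y2 w2 : α}
    (sX : X ⊆ a1) (sY : Y ⊆ a1) (sR : R ⊆ a2) (sβ : β ⊆ b2)
    (harc1 : ∀ ⦃p⦄, p ∈ X → p ∉ a2) (harc1' : ∀ ⦃p⦄, p ∈ Y → p ∉ a2)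
    (harc2 : ∀ ⦃p⦄, p ∈ R → p ∉ a1) (hβ1 : ∀ ⦃p⦄, p ∈ β → p ∉ b1)
    (hβ3 : ∀ ⦃p⦄, p ∈ β → p ∉ b3)
    (k11 : ∀ p, p ∈ a1 → p ∈ b1 → p = x1) (k12 : ∀ p, p ∈ a1 → p ∈ b2 → p = y1)
    (k13 : ∀ p, p ∈ a1 → p ∈ b3 → p = w1) (k21 : ∀ p, p ∈ a2 → p ∈ b1 → p = x2)
    (k22 : ∀ p, p ∈ a2 → p ∈ b2 → p = y2) (k23 : ∀ p, p ∈ a2 → p ∈ b3 → p = w2)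
    (hxY : x1 ∉ Y) (hwX : w1 ∉ X) (hyX : y1 ∈ X) (hyY : y1 ∈ Y) (y12 : y1 ∉ a2)
    (y21 : y2 ∉ a1) (hxX : x1 ∈ X) (hwY : w1 ∈ Y) (i j k l : Fin 3) (hik : i < k) (hjl : j ≠ l) :
    Disjoint
      ((![![a1 \ Y, a1 \ X, a2 \ {x2}], ![X, Y, β], ![b1 \ {x2}, b3 \ {w2}, (b1 \ {x1}) ∪ R]] :
        Fin 3 → Fin 3 → Set α) i j)
      ((![![a1 \ Y, a1 \ X, a2 \ {x2}], ![X, Y, β], ![b1 \ {x2}, b3 \ {w2}, (b1 \ {x1}) ∪ R]] :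
        Fin 3 → Fin 3 → Set α) k l) := by
  rw [Set.disjoint_left]
  intro p
  have e1 := @sX p
  have e2 := @sY p
  have e3 := @sR p
  have e4 := @sβ p
  have e5 := @harc1 p
  have e6 := @harc1' p
  have e7 := @harc2 p
  have e8 := @hβ1 p
  have e9 := @hβ3 p
  have f1 := k11 p
  have f2 := k12 p
  have f3 := k13 p
  have f4 := k21 p
  have f5 := k22 p
  have f6 := k23 p
  have g1 : p = x1 → p ∉ Y := fun h => h ▸ hxY
  have g2 : p = w1 → p ∉ X := fun h => h ▸ hwX
  have g3 : p = y1 → p ∈ X := fun h => h ▸ hyX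
  have g4 : p = y1 → p ∈ Y := fun h => h ▸ hyY
  have g5 : p = y1 → p ∉ a2 := fun h => h ▸ y12
  have g6 : p = y2 → p ∉ a1 := fun h => h ▸ y21
  have g7 : p = x1 → p ∈ X := fun h => h ▸ hxX
  have g8 : p = w1 → p ∈ Y := fun h => h ▸ hwY
  clear sX sY sR sβ harc1 harc1' harc2 hβ1 hβ3 k11 k12 k13 k21 k22 k23 hxY hwX hyX hyY y12 y21 hxX hwY
  fin_cases i <;> fin_cases k <;> first | (exfalso; revert hik; decide) | skip
  all_goals
    fin_cases j <;> fin_cases l <;> first | (exfalso; revert hjl; decide) | skip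
  all_goals
    clear hik hjl
    first | (simp; done) | (simp; grind only)

/-- The forbidden configuration of two plus three mutually touching curves. -/
theorem touching_core {a1 a2 b1 b2 b3 : Set Plane} {φ1 φ2 ψ1 ψ2 ψ3 : ℝ → Plane}
    (A1 : Param a1 φ1) (A2 : Param a2 φ2) (B1 : Param b1 ψ1) (B2 : Param b2 ψ2)
    (B3 : Param b3 ψ3) {z c : Plane} (hz1 : z ∈ a1) (hz2 : z ∈ a2) (hc1 : c ∈ b1) (hc3 : c ∈ b3)
    {sx sy sw rx ry q1 q2 : ℝ} {w2 : Plane}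
    (hsx : sx ∈ Set.Ico (0 : ℝ) 1) (hsy : sy ∈ Set.Ico (0 : ℝ) 1) (hsw : sw ∈ Set.Ico (0 : ℝ) 1)
    (horder : (sx < sy ∧ sy < sw) ∨ (sw < sy ∧ sy < sx))
    (h11 : a1 ∩ b1 = {φ1 sx}) (h12 : a1 ∩ b2 = {φ1 sy}) (h13 : a1 ∩ b3 = {φ1 sw})
    (h21 : a2 ∩ b1 = {φ2 rx}) (h22 : a2 ∩ b2 = {φ2 ry}) (h23 : a2 ∩ b3 = {w2})
    (hq1 : ψ2 q1 = φ1 sy) (hq2 : ψ2 q2 = φ2 ry)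
    (ha1 : ∀ p, p ∈ a1 → p ∈ a2 → p ∈ b1 → False)
    (ha2 : ∀ p, p ∈ a1 → p ∈ a2 → p ∈ b2 → False)
    (ha3 : ∀ p, p ∈ a1 → p ∈ a2 → p ∈ b3 → False)
    (hb113 : ∀ p, p ∈ a1 → p ∈ b1 → p ∈ b3 → False)
    (hb212 : ∀ p, p ∈ a2 → p ∈ b1 → p ∈ b2 → False)
    (hb213 : ∀ p, p ∈ a2 → p ∈ b1 → p ∈ b3 → False)
    (harc1 : Disjoint (φ1 '' Set.uIcc sx sy) a2) (harc1' : Disjoint (φ1 '' Set.uIcc sy sw) a2)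
    (harc2 : Disjoint (φ2 '' Set.uIcc rx ry) a1)
    (hβ1 : Disjoint (ψ2 '' Set.uIcc q1 q2) b1) (hβ3 : Disjoint (ψ2 '' Set.uIcc q1 q2) b3) :
    False := by
  set x1 := φ1 sx with hx1
  set y1 := φ1 sy with hy1
  set w1 := φ1 sw with hw1
  set x2 := φ2 rx with hx2
  set y2 := φ2 ry with hy2
  have k11 : ∀ p, p ∈ a1 → p ∈ b1 → p = x1 := fun p h h' => by
    have : p ∈ a1 ∩ b1 := ⟨h, h'⟩
    rwa [h11] at this
  have k12 : ∀ p, p ∈ a1 → p ∈ b2 → p = y1 := fun p h h' => by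
    have : p ∈ a1 ∩ b2 := ⟨h, h'⟩
    rwa [h12] at this
  have k13 : ∀ p, p ∈ a1 → p ∈ b3 → p = w1 := fun p h h' => by
    have : p ∈ a1 ∩ b3 := ⟨h, h'⟩
    rwa [h13] at this
  have k21 : ∀ p, p ∈ a2 → p ∈ b1 → p = x2 := fun p h h' => by
    have : p ∈ a2 ∩ b1 := ⟨h, h'⟩
    rwa [h21] at this
  have k22 : ∀ p, p ∈ a2 → p ∈ b2 → p = y2 := fun p h h' => by
    have : p ∈ a2 ∩ b2 := ⟨h, h'⟩
    rwa [h22] at this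
  have k23 : ∀ p, p ∈ a2 → p ∈ b3 → p = w2 := fun p h h' => by
    have : p ∈ a2 ∩ b3 := ⟨h, h'⟩
    rwa [h23] at this
  have m11 : x1 ∈ a1 ∧ x1 ∈ b1 := by rw [← Set.mem_inter_iff, h11]; rfl
  have m12 : y1 ∈ a1 ∧ y1 ∈ b2 := by rw [← Set.mem_inter_iff, h12]; rfl
  have m13 : w1 ∈ a1 ∧ w1 ∈ b3 := by rw [← Set.mem_inter_iff, h13]; rfl
  have m21 : x2 ∈ a2 ∧ x2 ∈ b1 := by rw [← Set.mem_inter_iff, h21]; rfl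
  have m22 : y2 ∈ a2 ∧ y2 ∈ b2 := by rw [← Set.mem_inter_iff, h22]; rfl
  have m23 : w2 ∈ a2 ∧ w2 ∈ b3 := by rw [← Set.mem_inter_iff, h23]; rfl
  have hIcc : ∀ {s t : ℝ}, s ∈ Set.Ico (0 : ℝ) 1 → t ∈ Set.Ico (0 : ℝ) 1 →
      Set.uIcc s t ⊆ Set.Ico (0 : ℝ) 1 := by
    intro s t hs ht r hr
    rw [Set.mem_uIcc] at hr
    rcases hr with hr | hr
    · exact ⟨hs.1.trans hr.1, lt_of_le_of_lt hr.2 ht.2⟩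
    · exact ⟨ht.1.trans hr.1, lt_of_le_of_lt hr.2 hs.2⟩
  have hxY : x1 ∉ φ1 '' Set.uIcc sy sw := by
    rintro ⟨r, hr, he⟩
    have := A1.injOn (hIcc hsy hsw hr) hsx he
    subst this
    rw [Set.mem_uIcc] at hr
    rcases horder with h | h <;> rcases hr with hr | hr <;> linarith [hr.1, hr.2, h.1, h.2]
  have hwX : w1 ∉ φ1 '' Set.uIcc sx sy := by
    rintro ⟨r, hr, he⟩
    have := A1.injOn (hIcc hsx hsy hr) hsw he
    subst this
    rw [Set.mem_uIcc] at hr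
    rcases horder with h | h <;> rcases hr with hr | hr <;> linarith [hr.1, hr.2, h.1, h.2]
  have hyX : y1 ∈ φ1 '' Set.uIcc sx sy := ⟨sy, Set.right_mem_uIcc, rfl⟩
  have hyY : y1 ∈ φ1 '' Set.uIcc sy sw := ⟨sy, Set.left_mem_uIcc, rfl⟩
  have hxX : x1 ∈ φ1 '' Set.uIcc sx sy := ⟨sx, Set.left_mem_uIcc, rfl⟩
  have hwY : w1 ∈ φ1 '' Set.uIcc sy sw := ⟨sw, Set.right_mem_uIcc, rfl⟩
  have jxy : JoinedIn (φ1 '' Set.uIcc sx sy) y1 x1 := (A1.joined_uIcc sx sy).symm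
  have jyw : JoinedIn (φ1 '' Set.uIcc sy sw) y1 w1 := A1.joined_uIcc sy sw
  have jr : JoinedIn (φ2 '' Set.uIcc rx ry) x2 y2 := A2.joined_uIcc rx ry
  have jβ : JoinedIn (ψ2 '' Set.uIcc q1 q2) y1 y2 := by
    have := B2.joined_uIcc q1 q2
    rwa [hq1, hq2] at this
  have sX := A1.image_subset (Set.uIcc sx sy)
  have sY := A1.image_subset (Set.uIcc sy sw)
  have sR := A2.image_subset (Set.uIcc rx ry)
  have sβ := B2.image_subset (Set.uIcc q1 q2)
  have zX : z ∉ φ1 '' Set.uIcc sx sy := fun h => Set.disjoint_left.mp harc1 h hz2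
  have zY : z ∉ φ1 '' Set.uIcc sy sw := fun h => Set.disjoint_left.mp harc1' h hz2
  have j00 : JoinedIn (a1 \ φ1 '' Set.uIcc sy sw) z x1 :=
    A1.joined_compl_uIcc hsy hsw hz1 m11.1 zY hxY
  have j01 : JoinedIn (a1 \ φ1 '' Set.uIcc sx sy) z w1 :=
    A1.joined_compl_uIcc hsx hsy hz1 m13.1 zX hwX
  generalize φ1 '' Set.uIcc sx sy = X at *
  generalize φ1 '' Set.uIcc sy sw = Y at *
  generalize φ2 '' Set.uIcc rx ry = R at *
  generalize ψ2 '' Set.uIcc q1 q2 = β at *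
  clear_value x1 y1 w1 x2 y2
  have j02 : JoinedIn (a2 \ {x2}) z y2 :=
    A2.joined_compl_singleton m21.1 hz2 m22.1 (by rintro rfl; exact ha1 _ hz1 hz2 m21.2)
      (by rintro rfl; exact hb212 _ m22.1 m21.2 m22.2)
  have j20 : JoinedIn (b1 \ {x2}) c x1 :=
    B1.joined_compl_singleton m21.2 hc1 m11.2 (by rintro rfl; exact hb213 _ m21.1 hc1 hc3)
      (by rintro rfl; exact ha1 _ m11.1 m21.1 m11.2)
  have j21 : JoinedIn (b3 \ {w2}) c w1 :=
    B3.joined_compl_singleton m23.2 hc3 m13.2 (by rintro rfl; exact hb213 _ m23.1 hc1 hc3)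
      (by rintro rfl; exact ha3 _ m13.1 m23.1 m13.2)
  have j22 : JoinedIn ((b1 \ {x1}) ∪ R) c y2 := by
    have : JoinedIn (b1 \ {x1}) c x2 :=
      B1.joined_compl_singleton m11.2 hc1 m21.2 (by rintro rfl; exact hb113 _ m11.1 hc1 hc3)
        (by rintro rfl; exact ha1 _ m11.1 m21.1 m11.2)
    exact (this.mono Set.subset_union_left).trans (jr.mono Set.subset_union_right)
  rw [Set.disjoint_left] at harc1 harc1' harc2 hβ1 hβ3
  have y12 : y1 ∉ a2 := fun h => ha2 _ m12.1 h m12.2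
  have y21 : y2 ∉ a1 := fun h => ha2 _ h m22.1 m22.2
  let E : Fin 3 → Fin 3 → Set Plane :=
    ![![a1 \ Y, a1 \ X, a2 \ {x2}], ![X, Y, β], ![b1 \ {x2}, b3 \ {w2}, (b1 \ {x1}) ∪ R]]
  have key : ∀ i j k l, i < k → j ≠ l → Disjoint (E i j) (E k l) :=
    disjoint_aux (sX := sX) (sY := sY) (sR := sR) (sβ := sβ) harc1 harc1' harc2 hβ1 hβ3
      k11 k12 k13 k21 k22 k23 hxY hwX hyX hyY y12 y21 hxX hwY
  refine K33_plane ![z, y1, c] ![x1, w1, y2] E ?_ ?_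
  · intro i j
    fin_cases i <;> fin_cases j
    exacts [j00, j01, j02, jxy, jyw, jβ, j20, j21, j22]
  · intro i j k l hik hjl
    rcases lt_or_gt_of_ne hik with h | h
    · exact key i j k l h hjl
    · exact (key k l i j h hjl.symm).symm

/-! ### No large complete bipartite subgraph in the touching graph -/

theorem exists_middle (a b c : ℝ) (hab : a ≠ b) (hac : a ≠ c) (hbc : b ≠ c) (g : Fin 3 → ℝ)
    (h0 : g 0 = a) (h1 : g 1 = b) (h2 : g 2 = c) :
    ∃ k : Fin 3, (g (k + 1) < g k ∧ g k < g (k + 2)) ∨ (g (k + 2) < g k ∧ g k < g (k + 1)) := by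
  have s1 : (1 + 1 : Fin 3) = 2 := rfl
  have s2 : (1 + 2 : Fin 3) = 0 := rfl
  have s3 : (2 + 1 : Fin 3) = 0 := rfl
  have s4 : (2 + 2 : Fin 3) = 1 := rfl
  rcases lt_or_gt_of_ne hab with h | h <;> rcases lt_or_gt_of_ne hac with h' | h' <;>
    rcases lt_or_gt_of_ne hbc with h'' | h''
  all_goals first
    | exact ⟨0, by simp only [zero_add, h0, h1, h2]; grind⟩
    | exact ⟨1, by simp only [s1, s2, h0, h1, h2]; grind⟩
    | exact ⟨2, by simp only [s3, s4, h0, h1, h2]; grind⟩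
    | (exfalso; linarith)

theorem no_biclique {m n : ℕ} {γ : Fin n → Set Plane} (hJ : ∀ i, IsJordanCurve (γ i))
    (hG : GenPos γ) (hM : MIntersecting m γ)
    (hI : ∀ i j : Fin n, i ≠ j → (γ i ∩ γ j).Nonempty) {t : ℕ} (ht : t = 6 * m + 4)
    (f : Fin t → Fin n) (hf : Function.Injective f) (S : Finset (Fin n))
    (hS : ∀ i, ∀ j ∈ S, f i ≠ j ∧ Touches (γ (f i)) (γ j)) :
    S.card ≤ (t * m + 1) ^ t * 2 := by
  classical
  by_contra hcard
  push Not at hcard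
  have nt : ∀ {i j k : Fin n}, i ≠ j → i ≠ k → j ≠ k → ∀ p, p ∈ γ i → p ∈ γ j → p ∈ γ k →
      False := by
    intro i j k hij hik hjk p h1 h2 h3
    rcases hG.2 p i j k h1 h2 h3 with h | h | h
    · exact hij h
    · exact hik h
    · exact hjk h
  choose φ hφ using fun i => (hJ i).exists_param
  have hP : ∀ (i : Fin t) (j : Fin n), ∃ p : Plane, j ∈ S → γ (f i) ∩ γ j = {p} := by
    intro i j
    by_cases hj : j ∈ S
    · obtain ⟨p, hp⟩ := (hS i j hj).2
      exact ⟨p, fun _ => hp⟩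
    · exact ⟨0, fun h => absurd h hj⟩
  choose P hP using hP
  have hPa : ∀ i, ∀ j ∈ S, P i j ∈ γ (f i) := fun i j hj => by
    have : P i j ∈ γ (f i) ∩ γ j := by rw [hP i j hj]; rfl
    exact this.1
  have hPb : ∀ i, ∀ j ∈ S, P i j ∈ γ j := fun i j hj => by
    have : P i j ∈ γ (f i) ∩ γ j := by rw [hP i j hj]; rfl
    exact this.2
  have hσ : ∀ (i : Fin t) (j : Fin n), ∃ s : ℝ, s ∈ Set.Ico (0 : ℝ) 1 ∧
      (j ∈ S → φ (f i) s = P i j) := by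
    intro i j
    by_cases hj : j ∈ S
    · obtain ⟨s, hs, he⟩ := (hφ (f i)).exists_mem_Ico (hPa i j hj) 0
      exact ⟨s, by simpa using hs, fun _ => he⟩
    · exact ⟨0, by simp, fun h => absurd h hj⟩
  choose σ hσ hσe using hσ
  have hσne : ∀ i, ∀ j ∈ S, ∀ k ∈ S, j ≠ k → σ i j ≠ σ i k := by
    intro i j hj k hk hjk he
    have hp : P i j = P i k := by rw [← hσe i j hj, ← hσe i k hk, he]
    exact nt (hS i j hj).1 (hS i k hk).1 hjk (P i j) (hPa i j hj) (hPb i j hj)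
      (hp ▸ hPb i k hk)
  -- the gaps on the curves `f i`
  have hcls : ∀ i : Fin t, ∃ c : ℝ → Fin (t * m + 1), ∀ j ∈ S, ∀ k ∈ S, c (σ i j) = c (σ i k) →
      ∀ i', i' ≠ i → Disjoint (φ (f i) '' Set.uIcc (σ i j) (σ i k)) (γ (f i')) := by
    intro i
    let Q : Set Plane := ⋃ i' ∈ (Finset.univ.erase i : Finset (Fin t)), γ (f i) ∩ γ (f i')
    have hfin : ∀ i' ∈ (Finset.univ.erase i : Finset (Fin t)), (γ (f i) ∩ γ (f i')).Finite := by
      intro i' hi'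
      exact hG.1 _ _ (hf.ne (Finset.ne_of_mem_erase hi').symm)
    have hQ : Q.Finite := Set.Finite.biUnion (Finset.finite_toSet _) hfin
    have hQc : Q.ncard ≤ t * m := by
      have h1 : Q.ncard ≤ ∑ i' ∈ (Finset.univ.erase i : Finset (Fin t)),
          (γ (f i) ∩ γ (f i')).ncard := Finset.set_ncard_biUnion_le _ _
      refine h1.trans ((Finset.sum_le_card_nsmul _ _ m ?_).trans ?_)
      · intro i' hi'
        exact hM _ _ (hf.ne (Finset.ne_of_mem_erase hi').symm)
      · rw [smul_eq_mul]
        exact Nat.mul_le_mul_right _ ((Finset.card_le_univ _).trans (by simp))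
    obtain ⟨c, hc⟩ := (hφ (f i)).exists_class hQ hQc
    have hnQ : ∀ j ∈ S, φ (f i) (σ i j) ∉ Q := by
      intro j hj hmem
      rw [hσe i j hj] at hmem
      simp only [Q, Set.mem_iUnion] at hmem
      obtain ⟨i', hi', h1, h2⟩ := hmem
      exact nt (hf.ne (Finset.ne_of_mem_erase hi').symm) (hS i j hj).1 (hS i' j hj).1 _ h1 h2
        (hPb i j hj)
    refine ⟨c, fun j hj k hk hjk i' hi' => ?_⟩
    have hd := hc _ (hσ i j) _ (hσ i k) (hnQ j hj) (hnQ k hk) hjk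
    rw [Set.disjoint_left] at hd ⊢
    intro p hp hp'
    refine hd hp ?_
    simp only [Q, Set.mem_iUnion]
    exact ⟨i', by simp [hi'], (hφ (f i)).image_subset _ hp, hp'⟩
  choose C hC using hcls
  -- three curves in the same gaps
  obtain ⟨F, -, hF⟩ := Finset.exists_lt_card_fiber_of_mul_lt_card_of_maps_to
    (s := S) (t := (Finset.univ : Finset (Fin t → Fin (t * m + 1))))
    (f := fun j i => C i (σ i j)) (n := 2) (fun _ _ => Finset.mem_univ _)
    (by simpa using hcard)
  obtain ⟨j1, hj1, j2, hj2, j3, hj3, h12, h13, h23⟩ := Finset.two_lt_card.mp hF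
  rw [Finset.mem_filter] at hj1 hj2 hj3
  let J : Fin 3 → Fin n := ![j1, j2, j3]
  have hJS : ∀ k, J k ∈ S := by
    intro k; fin_cases k
    exacts [hj1.1, hj2.1, hj3.1]
  have hJF : ∀ k i, C i (σ i (J k)) = F i := by
    intro k i; fin_cases k
    exacts [congrFun hj1.2 i, congrFun hj2.2 i, congrFun hj3.2 i]
  have hJinj : Function.Injective J := by
    intro k l hkl
    fin_cases k <;> fin_cases l <;> simp [J] at hkl ⊢ <;> grind
  have hmid : ∀ i : Fin t, ∃ k : Fin 3,
      (σ i (J (k + 1)) < σ i (J k) ∧ σ i (J k) < σ i (J (k + 2))) ∨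
      (σ i (J (k + 2)) < σ i (J k) ∧ σ i (J k) < σ i (J (k + 1))) := by
    intro i
    exact exists_middle (σ i (J 0)) (σ i (J 1)) (σ i (J 2))
      (hσne i _ (hJS 0) _ (hJS 1) (hJinj.ne (by decide)))
      (hσne i _ (hJS 0) _ (hJS 2) (hJinj.ne (by decide)))
      (hσne i _ (hJS 1) _ (hJS 2) (hJinj.ne (by decide))) (fun k => σ i (J k)) rfl rfl rfl
  choose mid hmid using hmid
  obtain ⟨k, -, hk⟩ := Finset.exists_lt_card_fiber_of_mul_lt_card_of_maps_to
    (s := (Finset.univ : Finset (Fin t))) (t := (Finset.univ : Finset (Fin 3)))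
    (f := mid) (n := 2 * m + 1) (fun _ _ => Finset.mem_univ _)
    (by simp; omega)
  set b2 := J k with hb2
  set b1 := J (k + 1) with hb1
  set b3 := J (k + 2) with hb3
  have n12 : b1 ≠ b2 := hJinj.ne ((by decide : ∀ k : Fin 3, k + 1 ≠ k) k)
  have n13 : b1 ≠ b3 := hJinj.ne ((by decide : ∀ k : Fin 3, k + 1 ≠ k + 2) k)
  have n23 : b2 ≠ b3 := hJinj.ne ((by decide : ∀ k : Fin 3, k ≠ k + 2) k)
  have S1 : b1 ∈ S := hJS _
  have S2 : b2 ∈ S := hJS _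
  have S3 : b3 ∈ S := hJS _
  -- parameters on `b2`
  have hρ : ∀ i : Fin t, ∃ s ∈ Set.Ico (0 : ℝ) 1, φ b2 s = P i b2 := by
    intro i
    have := (hφ b2).exists_mem_Ico (hPb i b2 S2) 0
    simpa using this
  choose ρ hρ hρe using hρ
  let Q : Set Plane := (γ b2 ∩ γ b1) ∪ (γ b2 ∩ γ b3)
  have hQ : Q.Finite := (hG.1 _ _ n12.symm).union (hG.1 _ _ n23)
  have hQc : Q.ncard ≤ 2 * m := by
    refine (Set.ncard_union_le _ _).trans ?_
    have := hM _ _ n12.symm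
    have := hM _ _ n23
    omega
  obtain ⟨c, hc⟩ := (hφ b2).exists_class hQ hQc
  have hnQ : ∀ i, φ b2 (ρ i) ∉ Q := by
    intro i hmem
    rw [hρe] at hmem
    rcases hmem with h | h
    · exact nt (hS i b1 S1).1 (hS i b2 S2).1 n12 _ (hPa i b2 S2) h.2 h.1
    · exact nt (hS i b2 S2).1 (hS i b3 S3).1 n23 _ (hPa i b2 S2) h.1 h.2
  obtain ⟨i, hi, i', hi', hne, hcc⟩ := Finset.exists_ne_map_eq_of_card_lt_of_maps_to
    (s := Finset.univ.filter (fun i => mid i = k))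
    (t := (Finset.univ : Finset (Fin (2 * m + 1)))) (by simpa using hk)
    (f := fun i => c (ρ i)) (fun _ _ => Finset.mem_univ _)
  have hd := hc _ (hρ i) _ (hρ i') (hnQ i) (hnQ i') hcc
  have hsub := (hφ b2).image_subset (Set.uIcc (ρ i) (ρ i'))
  rw [Finset.mem_filter] at hi hi'
  obtain ⟨z, hz1, hz2⟩ := hI (f i) (f i') (hf.ne hne)
  obtain ⟨x, hx1, hx3⟩ := hI b1 b3 n13
  have hord := hmid i
  rw [hi.2, ← hb1, ← hb2, ← hb3] at hord
  have same : ∀ i k l, C i (σ i (J k)) = C i (σ i (J l)) := fun i k l => by rw [hJF, hJF]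
  have fne := hf.ne hne
  refine touching_core (hφ (f i)) (hφ (f i')) (hφ b1) (hφ b2) (hφ b3) hz1 hz2 hx1 hx3
    (hσ i b1) (hσ i b2) (hσ i b3) hord (rx := σ i' b1) (ry := σ i' b2) (w2 := P i' b3)
    (q1 := ρ i) (q2 := ρ i')
    (by rw [hP i b1 S1, hσe i b1 S1]) (by rw [hP i b2 S2, hσe i b2 S2])
    (by rw [hP i b3 S3, hσe i b3 S3])
    (by rw [hP i' b1 S1, hσe i' b1 S1]) (by rw [hP i' b2 S2, hσe i' b2 S2])
    (hP i' b3 S3)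
    (by rw [hρe i, hσe i b2 S2]) (by rw [hρe i', hσe i' b2 S2])
    (nt fne (hS i b1 S1).1 (hS i' b1 S1).1)
    (nt fne (hS i b2 S2).1 (hS i' b2 S2).1)
    (nt fne (hS i b3 S3).1 (hS i' b3 S3).1)
    (nt (hS i b1 S1).1 (hS i b3 S3).1 n13)
    (nt (hS i' b1 S1).1 (hS i' b2 S2).1 n12)
    (nt (hS i' b1 S1).1 (hS i' b3 S3).1 n13)
    (hC i b1 S1 b2 S2 (same i _ _) i' hne.symm)
    (hC i b2 S2 b3 S3 (same i _ _) i' hne.symm)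
    (hC i' b1 S1 b2 S2 (same i' _ _) i hne) ?_ ?_
  · rw [Set.disjoint_left] at hd ⊢
    exact fun p hp hp' => hd hp (Or.inl ⟨hsub hp, hp'⟩)
  · rw [Set.disjoint_left] at hd ⊢
    exact fun p hp hp' => hd hp (Or.inr ⟨hsub hp, hp'⟩)

/-! ### A Kővári–Sós–Turán bound -/

theorem card_not_injective_le (n t : ℕ) :
    (Finset.univ.filter (fun f : Fin (t + 1) → Fin n => ¬ Function.Injective f)).card
      ≤ (t + 1) ^ 2 * n ^ t := by
  classical
  have h1 : (Finset.univ.filter (fun f : Fin (t + 1) → Fin n => ¬ Function.Injective f)) ⊆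
      (Finset.univ : Finset (Fin (t + 1) × Fin (t + 1))).biUnion
        (fun q => Finset.univ.filter (fun f => q.1 ≠ q.2 ∧ f q.1 = f q.2)) := by
    intro f hf
    have hf := (Finset.mem_filter.mp hf).2
    simp only [Function.Injective] at hf
    push Not at hf
    obtain ⟨a, b, hab, hne⟩ := hf
    simp only [Finset.mem_biUnion, Finset.mem_univ, true_and, Finset.mem_filter]
    exact ⟨(a, b), hne, hab⟩
  refine (Finset.card_le_card h1).trans ((Finset.card_biUnion_le_card_mul _ _ (n ^ t) ?_).trans ?_)
  · rintro ⟨a, b⟩ -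
    by_cases hab : a = b
    · simp [hab]
    have h2 : (Finset.univ.filter
        (fun f : Fin (t + 1) → Fin n => (a, b).1 ≠ (a, b).2 ∧ f (a, b).1 = f (a, b).2)).card ≤
        (Finset.univ : Finset ({x : Fin (t + 1) // x ≠ a} → Fin n)).card := by
      refine Finset.card_le_card_of_injOn (fun f x => f x.1) (fun _ _ => Finset.mem_univ _) ?_
      intro f hf g hg hfg
      simp only [Finset.coe_filter, Set.mem_setOf_eq, Finset.mem_univ, true_and] at hf hg
      have key : ∀ x, x ≠ a → f x = g x := fun x hx => congrFun hfg ⟨x, hx⟩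
      funext x
      by_cases hx : x = a
      · subst hx
        rw [hf.2, hg.2]
        exact key b (Ne.symm hab)
      · exact key x hx
    refine h2.trans ?_
    simp
  · simp [sq]

theorem inner_pow_aux {n t : ℕ} (g : Fin n → ℕ) :
    (∑ j, g j) ^ (t + 1) ≤ n ^ t * ∑ j, g j ^ (t + 1) := by
  have h := pow_sum_le_card_mul_sum_pow (s := Finset.univ) (f := g) (fun _ _ => Nat.zero_le _) t
  simpa using h

theorem kst {n t B : ℕ} (A : Fin n → Fin n → Prop)
    (h : ∀ (f : Fin (t + 1) → Fin n) (_ : Function.Injective f) (S : Finset (Fin n)),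
      (∀ i, ∀ j ∈ S, A (f i) j) → S.card ≤ B) (e : ℕ)
    (he : e ≤ {p : Fin n × Fin n | A p.1 p.2}.ncard) :
    e ^ (t + 1) ≤ (B + (t + 1) ^ 2) * n ^ (2 * t + 1) := by
  classical
  have hsum : {p : Fin n × Fin n | A p.1 p.2}.ncard =
      ∑ j, (Finset.univ.filter (fun i => A i j)).card := by
    rw [Set.ncard_eq_toFinset_card']
    rw [Finset.card_eq_sum_card_fiberwise (f := Prod.snd) (t := Finset.univ)
      (fun _ _ => Finset.mem_univ _)]
    refine Finset.sum_congr rfl fun j _ => ?_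
    refine Finset.card_bij (fun p _ => p.1) ?_ ?_ ?_
    · rintro ⟨a, b⟩ hp
      simp at hp ⊢
      rw [← hp.2]; exact hp.1
    · rintro ⟨a, b⟩ hp ⟨a', b'⟩ hp' hh
      simp at hp hp' hh ⊢
      exact ⟨hh, hp.2.trans hp'.2.symm⟩
    · intro a ha
      simp at ha
      exact ⟨(a, j), by simpa using ha, rfl⟩
  have hpow : (∑ j, (Finset.univ.filter (fun i => A i j)).card) ^ (t + 1) ≤
      n ^ t * ∑ j, (Finset.univ.filter (fun i => A i j)).card ^ (t + 1) := by
    have := inner_pow_aux (n := n) (t := t) (fun j => (Finset.univ.filter (fun i => A i j)).card)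
    exact this
  have hcount : ∑ j, (Finset.univ.filter (fun i => A i j)).card ^ (t + 1) =
      ∑ f : Fin (t + 1) → Fin n, (Finset.univ.filter (fun j => ∀ i, A (f i) j)).card := by
    have : ∀ j, (Finset.univ.filter (fun i => A i j)).card ^ (t + 1) =
        (Finset.univ.filter (fun f : Fin (t + 1) → Fin n => ∀ i, A (f i) j)).card := by
      intro j
      have h1 : (Finset.univ.filter (fun f : Fin (t + 1) → Fin n => ∀ i, A (f i) j)) =
          Fintype.piFinset (fun _ => Finset.univ.filter (fun i => A i j)) := by
        ext f; simp [Fintype.mem_piFinset]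
      rw [h1, Fintype.card_piFinset]
      simp
    simp_rw [this, Finset.card_filter]
    exact Finset.sum_comm
  have hbound : ∑ f : Fin (t + 1) → Fin n, (Finset.univ.filter (fun j => ∀ i, A (f i) j)).card ≤
      n ^ (t + 1) * B + ((t + 1) ^ 2 * n ^ t) * n := by
    rw [← Finset.sum_filter_add_sum_filter_not Finset.univ
      (fun f : Fin (t + 1) → Fin n => Function.Injective f)]
    refine add_le_add ?_ ?_
    · refine (Finset.sum_le_card_nsmul _ _ B ?_).trans ?_
      · intro f hf
        refine h f (Finset.mem_filter.mp hf).2 _ ?_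
        intro i j hj
        exact (Finset.mem_filter.mp hj).2 i
      · rw [smul_eq_mul]
        refine Nat.mul_le_mul_right _ ((Finset.card_le_univ _).trans ?_)
        simp
    · refine (Finset.sum_le_card_nsmul _ _ n ?_).trans ?_
      · intro f hf
        exact (Finset.card_le_univ _).trans (by simp)
      · rw [smul_eq_mul]
        exact Nat.mul_le_mul_right _ (card_not_injective_le n t)
  calc e ^ (t + 1) ≤ (∑ j, (Finset.univ.filter (fun i => A i j)).card) ^ (t + 1) :=
        Nat.pow_le_pow_left (he.trans hsum.le) _
    _ ≤ n ^ t * (n ^ (t + 1) * B + ((t + 1) ^ 2 * n ^ t) * n) :=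
        hpow.trans (Nat.mul_le_mul_left _ (hcount.le.trans hbound))
    _ = (B + (t + 1) ^ 2) * n ^ (2 * t + 1) := by ring

/-- Salazar's theorem: there is `C_Sal > 0` such that for each `m > 1`, every
`m`-intersecting family of `n` pairwise intersecting closed Jordan curves in general
position has at most `K · n^(2 - C_Sal/m)` touching pairs. -/
theorem salazar_touching_bound :
    ∃ CSal : ℝ, 0 < CSal ∧
      ∀ m : ℕ, 1 < m →
        ∃ K : ℝ, 0 < K ∧
          ∀ (n : ℕ) (γ : Fin n → Set Plane),
            Function.Injective γ →
            (∀ i, IsJordanCurve (γ i)) →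
            GenPos γ →
            MIntersecting m γ →
            (∀ i j : Fin n, i ≠ j → (γ i ∩ γ j).Nonempty) →
            (touchingPairs γ : ℝ) ≤ K * (n : ℝ) ^ ((2 : ℝ) - CSal / m) := by
  refine ⟨1 / 10, by norm_num, fun m hm => ?_⟩
  obtain ⟨t, ht⟩ : ∃ t, t + 1 = 6 * m + 4 := ⟨6 * m + 3, rfl⟩
  set B : ℕ := ((t + 1) * m + 1) ^ (t + 1) * 2 with hB
  set D : ℕ := B + (t + 1) ^ 2 with hD
  have hDpos : (0 : ℝ) < D := by
    have : 0 < D := by positivity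
    exact_mod_cast this
  refine ⟨(D : ℝ) ^ ((1 : ℝ) / ((t + 1 : ℕ) : ℝ)), Real.rpow_pos_of_pos hDpos _, ?_⟩
  intro n γ _ hJ hG hM hI
  have hk := kst (t := t) (B := B) (fun i j : Fin n => i ≠ j ∧ Touches (γ i) (γ j))
    (fun f hf S hS => no_biclique hJ hG hM hI ht f hf S hS) (touchingPairs γ) (by
      refine Set.ncard_le_ncard ?_ (Set.toFinite _)
      rintro ⟨a, b⟩ ⟨h1, h2⟩
      exact ⟨h1.ne, h2⟩)
  rcases Nat.eq_zero_or_pos n with rfl | hn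
  · have : touchingPairs γ = 0 := by
      have hk' : touchingPairs γ ^ (t + 1) ≤ 0 := by simpa using hk
      exact pow_eq_zero_iff (by omega) |>.mp (Nat.le_zero.mp hk')
    rw [this, Nat.cast_zero]
    positivity
  have hn1 : (1 : ℝ) ≤ n := by exact_mod_cast hn
  have hn0 : (0 : ℝ) < n := by linarith
  have ht0 : (0 : ℝ) < ((t + 1 : ℕ) : ℝ) := by positivity
  have hkR : ((touchingPairs γ : ℝ)) ^ (t + 1) ≤ D * (n : ℝ) ^ (2 * t + 1) := by
    exact_mod_cast hk
  have h1 : (touchingPairs γ : ℝ) ≤ ((D : ℝ) * (n : ℝ) ^ (2 * t + 1)) ^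
      ((1 : ℝ) / ((t + 1 : ℕ) : ℝ)) := by
    have := Real.rpow_le_rpow (by positivity) hkR
      (show (0 : ℝ) ≤ (1 : ℝ) / ((t + 1 : ℕ) : ℝ) by positivity)
    rwa [one_div, Real.pow_rpow_inv_natCast (by positivity) (by omega), ← one_div] at this
  refine h1.trans ?_
  rw [Real.mul_rpow hDpos.le (by positivity)]
  refine mul_le_mul_of_nonneg_left ?_ (by positivity)
  rw [← Real.rpow_natCast, ← Real.rpow_mul hn0.le]
  refine Real.rpow_le_rpow_of_exponent_le hn1 ?_
  have hm0 : (1 : ℝ) < m := by exact_mod_cast hm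
  have htm : ((t + 1 : ℕ) : ℝ) = 6 * m + 4 := by rw [ht]; push_cast; ring
  have e1 : ((2 * t + 1 : ℕ) : ℝ) = 2 * ((t + 1 : ℕ) : ℝ) - 1 := by push_cast; ring
  rw [e1, htm]
  have e2 : (1 : ℝ) / 10 / m ≤ 1 / (6 * m + 4) := by
    rw [div_div]
    exact one_div_le_one_div_of_le (by linarith) (by linarith)
  have e3 : (2 * (6 * (m : ℝ) + 4) - 1) * (1 / (6 * m + 4)) = 2 - 1 / (6 * m + 4) := by
    field_simp
  rw [e3]
  linarith
end
end

section
/- For all positive integers s and t there exists a constant C > 0 (depending only on s and t) such that every finite simple graph G on n vertices that contains no copy of the complete bipartite graph K_{s,t} (i.e., there are no disjoint vertex sets S and T with |S| = s, |T| = t such that every vertex of S is adjacent to every vertex of T) has at most C · n^(2 − 1/s) edges. -/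
theorem kst_count (s t : ℕ) {V : Type} [Fintype V] [DecidableEq V] (G : SimpleGraph V)
    [DecidableRel G.Adj]
    (h : ¬∃ S T : Finset V, Disjoint S T ∧ S.card = s ∧ T.card = t ∧
            ∀ a ∈ S, ∀ b ∈ T, G.Adj a b) :
    ∑ v, (G.degree v).choose s ≤ (Fintype.card V) ^ s * t := by
  have h1 : ∀ v, (G.degree v).choose s =
      ∑ S ∈ Finset.powersetCard s (Finset.univ : Finset V),
        if S ⊆ G.neighborFinset v then 1 else 0 := by
    intro v
    rw [← Finset.card_filter, ← G.card_neighborFinset_eq_degree, ← Finset.card_powersetCard]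
    congr 1
    ext S
    simp only [Finset.mem_powersetCard, Finset.mem_filter, Finset.subset_univ, true_and]
    tauto
  simp_rw [h1]
  rw [Finset.sum_comm]
  have h2 : ∀ S ∈ Finset.powersetCard s (Finset.univ : Finset V),
      (∑ v, if S ⊆ G.neighborFinset v then 1 else 0) ≤ t := by
    intro S hS
    rw [← Finset.card_filter]
    by_contra! hlt
    obtain ⟨T, hT, hTc⟩ := Finset.exists_subset_card_eq hlt.le
    have hadj : ∀ a ∈ S, ∀ b ∈ T, G.Adj a b := by
      intro a ha b hb
      have := (Finset.mem_filter.1 (hT hb)).2 ha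
      exact ((G.mem_neighborFinset _ _).1 this).symm
    refine h ⟨S, T, ?_, (Finset.mem_powersetCard.1 hS).2, hTc, hadj⟩
    rw [Finset.disjoint_left]
    intro a ha hb
    exact G.loopless.irrefl a (hadj a ha a hb)
  refine (Finset.sum_le_card_nsmul _ _ _ h2).trans ?_
  rw [Finset.card_powersetCard, smul_eq_mul, Finset.card_univ]
  exact Nat.mul_le_mul_right _ (Nat.choose_le_pow _ _)

theorem kst_pow (s t : ℕ) (hs : 0 < s) {V : Type} [Fintype V] [DecidableEq V]
    (G : SimpleGraph V) [DecidableRel G.Adj]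
    (h : ¬∃ S T : Finset V, Disjoint S T ∧ S.card = s ∧ T.card = t ∧
            ∀ a ∈ S, ∀ b ∈ T, G.Adj a b) :
    (∑ v, (G.degree v + 1 - s)) ^ s ≤ (s.factorial * t) * (Fintype.card V) ^ (2 * s - 1) := by
  obtain ⟨k, rfl⟩ : ∃ k, s = k + 1 := ⟨s - 1, by omega⟩
  have h1 : ∑ v, (G.degree v + 1 - (k + 1)) ^ (k + 1)
      ≤ (k + 1).factorial * ((Fintype.card V) ^ (k + 1) * t) := by
    refine le_trans ?_ (Nat.mul_le_mul_left _ (kst_count (k + 1) t G h))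
    rw [Finset.mul_sum]
    refine Finset.sum_le_sum fun v _ => ?_
    rw [← Nat.descFactorial_eq_factorial_mul_choose]
    exact Nat.pow_sub_le_descFactorial _ _
  have h2 : (∑ v, (G.degree v + 1 - (k + 1))) ^ (k + 1) ≤
      (Fintype.card V) ^ k * ∑ v, (G.degree v + 1 - (k + 1)) ^ (k + 1) := by
    have h3 := pow_sum_div_card_le_sum_pow (s := (Finset.univ : Finset V))
      (f := fun v => ((G.degree v + 1 - (k + 1) : ℕ) : ℝ)) (fun _ _ => Nat.cast_nonneg _) k
    rw [Finset.card_univ] at h3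
    rcases Nat.eq_zero_or_pos (Fintype.card V) with h0 | h0
    · have := Fintype.card_eq_zero_iff.1 h0
      simp
    · rw [div_le_iff₀ (by positivity)] at h3
      rw [mul_comm]
      exact_mod_cast h3
  refine h2.trans ((Nat.mul_le_mul_left _ h1).trans (le_of_eq ?_))
  have : 2 * (k + 1) - 1 = k + (k + 1) := by omega
  rw [this, pow_add]
  ring

/-- Kővári–Sós–Turán theorem: for fixed `s, t ≥ 1` there is `C > 0` such that every
finite simple graph on `n` vertices containing no copy of `K_{s,t}` has at most
`C · n^(2 - 1/s)` edges. -/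
theorem kovari_sos_turan (s t : ℕ) (hs : 0 < s) (ht : 0 < t) :
    ∃ C : ℝ, 0 < C ∧
      ∀ (V : Type) [Fintype V] (G : SimpleGraph V),
        (¬∃ S T : Finset V, Disjoint S T ∧ S.card = s ∧ T.card = t ∧
            ∀ a ∈ S, ∀ b ∈ T, G.Adj a b) →
        (G.edgeSet.ncard : ℝ) ≤ C * (Fintype.card V : ℝ) ^ ((2 : ℝ) - 1 / (s : ℝ)) := by
  have hs' : (1 : ℝ) ≤ s := by exact_mod_cast hs
  have hK : 1 ≤ s.factorial * t := Nat.mul_pos s.factorial_pos ht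
  set K := s.factorial * t with hKdef
  refine ⟨(K : ℝ) + s, by positivity, ?_⟩
  intro V _ G h
  classical
  have hp := kst_pow s t hs G h
  rw [← hKdef] at hp
  set n := Fintype.card V with hn
  have hsum : G.edgeSet.ncard ≤ ∑ v, (G.degree v + 1 - s) + s * n := by
    have e1 : G.edgeSet.ncard = G.edgeFinset.card := by
      rw [← SimpleGraph.coe_edgeFinset, Set.ncard_coe_finset]
    have e2 := G.sum_degrees_eq_twice_card_edges
    have e3 : ∑ v, G.degree v ≤ ∑ v, ((G.degree v + 1 - s) + s) :=
      Finset.sum_le_sum fun v _ => by omega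
    rw [Finset.sum_add_distrib, Finset.sum_const, Finset.card_univ, smul_eq_mul, ← hn,
      mul_comm n s] at e3
    omega
  set A := ∑ v, (G.degree v + 1 - s) with hA
  have hinv : (1 : ℝ) / s ≤ 1 := by rw [div_le_one (by linarith)]; exact hs'
  have hAle : (A : ℝ) ≤ K * (n : ℝ) ^ ((2 : ℝ) - 1 / (s : ℝ)) := by
    refine le_of_pow_le_pow_left₀ hs.ne' (by positivity) ?_
    rw [mul_pow, ← Real.rpow_mul_natCast (by positivity)]
    have e : ((2 : ℝ) - 1 / (s : ℝ)) * s = ((2 * s - 1 : ℕ) : ℝ) := by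
      rw [Nat.cast_sub (by omega)]
      push_cast
      field_simp
    rw [e, Real.rpow_natCast]
    have h3 : A ^ s ≤ K ^ s * n ^ (2 * s - 1) :=
      hp.trans (Nat.mul_le_mul_right _ (Nat.le_self_pow hs.ne' K))
    exact_mod_cast h3
  have hnle : (n : ℝ) ≤ (n : ℝ) ^ ((2 : ℝ) - 1 / (s : ℝ)) := by
    rcases Nat.eq_zero_or_pos n with h0 | h0
    · rw [h0, Nat.cast_zero]; exact Real.rpow_nonneg le_rfl _
    · exact Real.self_le_rpow_of_one_le (by exact_mod_cast h0) (by linarith)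
  have hsum' : (G.edgeSet.ncard : ℝ) ≤ A + s * n := by exact_mod_cast hsum
  have := mul_le_mul_of_nonneg_left hnle (by linarith : (0 : ℝ) ≤ s)
  linarith
end
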